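/- Let μ, α, β, σ > 0 and r ≥ 3 with, in case r = 3, the additional condition 2βμ ≥ 1, and let g ∈ C_c^∞(ℝ³; ℝ³) be divergence-free. There exists a constant R > 0, depending only on μ, α, β, σ, r and g, such that the following holds. Let y : ℝ → ℝ be continuous, let f : ℝ × ℝ³ → ℝ³ be continuous with ∫_{ℝ³}|f(t,x)|² dx < ∞ for every t, let u : ℝ × ℝ³ → ℝ³ be smooth with, for each bounded time interval, a single compact set K ⊂ ℝ³ containing the support of u(t,·) for all t in that interval, let u(t,·) be divergence-free for every t, and let p : ℝ × ℝ³ → ℝ be continuously differentiable in x, such that ∂u/∂t − μΔu + ((u + g y(t))·∇)(u + g y(t)) + αu + β|u + g y(t)|^{r−1}(u + g y(t)) = −∇p + f + (σ − α) g y(t) + μ y(t) Δg holds pointwise on ℝ × ℝ³. Then the function E(t) := ∫_{ℝ³}|u(t,x)|² dx is differentiable and for every t: E′(t) + (3α/2) E(t) + μ ∫_{ℝ³}|∇u(t,x)|² dx + β ∫_{ℝ³}|u(t,x) + g(x) y(t)|^{r+1} dx ≤ R ( ∫_{ℝ³}|f(t,x)|² dx + |y(t)|² + |y(t)|^{r+1}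 + |y(t)|^{2(r+1)/(r−1)} ). -/

import Mathlib

open MeasureTheory Filter

noncomputable section

/-- ℝ³ as a Euclidean space. -/
abbrev E3 : Type := EuclideanSpace ℝ (Fin 3)

/-- Partial derivative `∂g/∂xᵢ` of a scalar function on ℝ³. -/
def pd (i : Fin 3) (g : E3 → ℝ) (x : E3) : ℝ :=
  fderiv ℝ g x (EuclideanSpace.single i 1)

/-- The Laplacian of a scalar function on ℝ³. -/
def lap (g : E3 → ℝ) (x : E3) : ℝ :=
  ∑ i : Fin 3, pd i (fun y => pd i g y) x

/-- `|∇v|² = ∑_{i,j} (∂vⱼ/∂xᵢ)²` for a vector field on ℝ³. -/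
def gradSq (v : E3 → E3) (x : E3) : ℝ :=
  ∑ i : Fin 3, ∑ j : Fin 3, (pd i (fun y => v y j) x) ^ 2

theorem exists_young_le {p q ε : ℝ} (hpq : p.HolderConjugate q) (hε : 0 < ε) :
    ∃ C : ℝ, 0 ≤ C ∧ ∀ a b : ℝ, 0 ≤ a → 0 ≤ b → a * b ≤ ε * a ^ p + C * b ^ q := by
  have hp := hpq.lt
  have hq := hpq.symm.lt
  set s := ε ^ (1 / p) with hs
  have hs0 : 0 < s := Real.rpow_pos_of_pos hε _
  refine ⟨(s⁻¹) ^ q, by positivity, fun a b ha hb => ?_⟩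
  have h := Real.young_inequality_of_nonneg (mul_nonneg hs0.le ha)
    (mul_nonneg (inv_pos.2 hs0).le hb) hpq
  have e1 : s * a * (s⁻¹ * b) = a * b := by field_simp
  rw [e1, Real.mul_rpow hs0.le ha, Real.mul_rpow (inv_pos.2 hs0).le hb] at h
  have e2 : s ^ p = ε := by
    rw [hs, ← Real.rpow_mul hε.le, one_div, inv_mul_cancel₀ (by linarith), Real.rpow_one]
  rw [e2] at h
  refine h.trans (add_le_add ?_ ?_) <;> exact div_le_self (by positivity) (by linarith)

theorem two_mul_le_eps {ε : ℝ} (hε : 0 < ε) (a b : ℝ) : 2 * (a * b) ≤ ε * a ^ 2 + b ^ 2 / ε := by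
  have h : ε * a ^ 2 + b ^ 2 / ε - 2 * (a * b) = (ε * a - b) ^ 2 / ε := by
    field_simp
    ring
  have : 0 ≤ (ε * a - b) ^ 2 / ε := by positivity
  linarith

theorem exists_absorption_const {α β r : ℝ} (hα : 0 < α) (hβ : 0 < β) (hr : 3 ≤ r)
    (A B D c : ℝ) (hB : 0 ≤ B) :
    ∃ C : ℝ, 0 ≤ C ∧ ∀ a b Y F : ℝ, 0 ≤ a → 0 ≤ b → 0 ≤ Y → 0 ≤ F →
      2 * (A * Y * b * a + B * Y * b ^ r + D * F * a + c * Y * a)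
        ≤ α / 2 * a ^ 2 + β * b ^ (r + 1)
          + C * (F ^ 2 + (Y ^ 2 + Y ^ (r + 1) + Y ^ (2 * (r + 1) / (r - 1)))) := by
  have hα8 : 0 < α / 8 := by positivity
  set k := A ^ 2 / (α / 8) with hk
  have hk0 : 0 ≤ k := by positivity
  have hpq1 : ((r + 1) / 2).HolderConjugate ((r + 1) / (r - 1)) := by
    rw [Real.holderConjugate_iff]
    refine ⟨by linarith, ?_⟩
    have : r - 1 ≠ 0 := by linarith
    have : r + 1 ≠ 0 := by linarith
    field_simp
    ring
  have hpq2 : ((r + 1) / r).HolderConjugate (r + 1) := by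
    rw [Real.holderConjugate_iff]
    have : 0 < r := by linarith
    refine ⟨by rw [lt_div_iff₀ this]; linarith, ?_⟩
    have : r + 1 ≠ 0 := by linarith
    field_simp
  obtain ⟨C1, hC1, h1⟩ := exists_young_le hpq1 (show 0 < β / (2 * (k + 1)) by positivity)
  obtain ⟨C2, hC2, h2⟩ := exists_young_le hpq2 (show 0 < β / (2 * (2 * B + 1)) by positivity)
  refine ⟨(k + 1) * C1 + (2 * B + 1) * C2 + D ^ 2 / (α / 8) + c ^ 2 / (α / 8), by positivity,
    fun a b Y F ha hb hY hF => ?_⟩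
  have i1 : 2 * (A * Y * b * a) ≤ α / 8 * a ^ 2 + k * (b ^ 2 * Y ^ 2) := by
    have := two_mul_le_eps hα8 a (A * Y * b)
    have e : (A * Y * b) ^ 2 / (α / 8) = k * (b ^ 2 * Y ^ 2) := by rw [hk]; ring
    linarith
  have j1 := h1 (b ^ 2) (Y ^ 2) (by positivity) (by positivity)
  have e1 : (b ^ 2) ^ ((r + 1) / 2) = b ^ (r + 1) := by
    rw [← Real.rpow_natCast b 2, ← Real.rpow_mul hb]; congr 1; push_cast; ring
  have e2 : (Y ^ 2) ^ ((r + 1) / (r - 1)) = Y ^ (2 * (r + 1) / (r - 1)) := by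
    rw [← Real.rpow_natCast Y 2, ← Real.rpow_mul hY]; congr 1; push_cast; ring
  rw [e1, e2] at j1
  have hbr : 0 ≤ b ^ (r + 1) := by positivity
  have hY1 : 0 ≤ Y ^ (r + 1) := by positivity
  have hY2 : 0 ≤ Y ^ (2 * (r + 1) / (r - 1)) := by positivity
  have i1' : k * (b ^ 2 * Y ^ 2) ≤ β / 2 * b ^ (r + 1)
      + (k + 1) * C1 * Y ^ (2 * (r + 1) / (r - 1)) := by
    have h3 : k * (b ^ 2 * Y ^ 2) ≤ (k + 1) * (b ^ 2 * Y ^ 2) := by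
      gcongr; linarith
    have h4 := mul_le_mul_of_nonneg_left j1 (show 0 ≤ k + 1 by positivity)
    have e : (k + 1) * (β / (2 * (k + 1)) * b ^ (r + 1) + C1 * Y ^ (2 * (r + 1) / (r - 1)))
      = β / 2 * b ^ (r + 1) + (k + 1) * C1 * Y ^ (2 * (r + 1) / (r - 1)) := by field_simp
    linarith
  have j2 := h2 (b ^ r) Y (by positivity) hY
  have e3 : (b ^ r) ^ ((r + 1) / r) = b ^ (r + 1) := by
    rw [← Real.rpow_mul hb]; congr 1; field_simp
  rw [e3] at j2
  have i2 : 2 * (B * Y * b ^ r) ≤ β / 2 * b ^ (r + 1) + (2 * B + 1) * C2 * Y ^ (r + 1) := by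
    have h3 : 2 * B * (b ^ r * Y) ≤ (2 * B + 1) * (b ^ r * Y) := by
      gcongr; linarith
    have h4 := mul_le_mul_of_nonneg_left j2 (show 0 ≤ 2 * B + 1 by positivity)
    have e : (2 * B + 1) * (β / (2 * (2 * B + 1)) * b ^ (r + 1) + C2 * Y ^ (r + 1))
      = β / 2 * b ^ (r + 1) + (2 * B + 1) * C2 * Y ^ (r + 1) := by field_simp
    linarith
  have i3 : 2 * (D * F * a) ≤ α / 8 * a ^ 2 + D ^ 2 / (α / 8) * F ^ 2 := by
    have := two_mul_le_eps hα8 a (D * F)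
    have e : (D * F) ^ 2 / (α / 8) = D ^ 2 / (α / 8) * F ^ 2 := by ring
    linarith
  have i4 : 2 * (c * Y * a) ≤ α / 8 * a ^ 2 + c ^ 2 / (α / 8) * Y ^ 2 := by
    have := two_mul_le_eps hα8 a (c * Y)
    have e : (c * Y) ^ 2 / (α / 8) = c ^ 2 / (α / 8) * Y ^ 2 := by ring
    linarith
  have hd : 0 ≤ D ^ 2 / (α / 8) := by positivity
  have hc : 0 ≤ c ^ 2 / (α / 8) := by positivity
  set d' := D ^ 2 / (α / 8)
  set c' := c ^ 2 / (α / 8)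
  have hK1 : 0 ≤ (k + 1) * C1 := by positivity
  have hK2 : 0 ≤ (2 * B + 1) * C2 := by positivity
  set K1 := (k + 1) * C1
  set K2 := (2 * B + 1) * C2
  have hF2 : 0 ≤ F ^ 2 := by positivity
  have hYY : 0 ≤ Y ^ 2 := by positivity
  set y1 := Y ^ (r + 1)
  set y2 := Y ^ (2 * (r + 1) / (r - 1))
  have n1 : K1 * y2 ≤ K1 * (F ^ 2 + (Y ^ 2 + y1 + y2)) := by gcongr; linarith
  have n2 : K2 * y1 ≤ K2 * (F ^ 2 + (Y ^ 2 + y1 + y2)) := by gcongr; linarith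
  have n3 : d' * F ^ 2 ≤ d' * (F ^ 2 + (Y ^ 2 + y1 + y2)) := by gcongr; linarith
  have n4 : c' * Y ^ 2 ≤ c' * (F ^ 2 + (Y ^ 2 + y1 + y2)) := by gcongr; linarith
  nlinarith

theorem HasFDerivAt.pd_eq {φ : E3 → ℝ} {L : E3 →L[ℝ] ℝ} {x : E3} (h : HasFDerivAt φ L x)
    (i : Fin 3) : pd i φ x = L (EuclideanSpace.single i 1) := by
  rw [pd, h.fderiv]

theorem ContDiff.pd {φ : E3 → ℝ} {m n : WithTop ℕ∞} (h : ContDiff ℝ n φ) (hmn : m + 1 ≤ n)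
    (i : Fin 3) : ContDiff ℝ m (pd i φ) :=
  (h.fderiv_right hmn).clm_apply contDiff_const

theorem integrable_pd {φ : E3 → ℝ} (hφ : ContDiff ℝ 1 φ) (hc : HasCompactSupport φ)
    (i : Fin 3) : Integrable (pd i φ) :=
  (hφ.pd (m := 0) (by simp) i).continuous.integrable_of_hasCompactSupport
    (hc.fderiv_apply (𝕜 := ℝ) _)

theorem integral_pd_eq_zero {φ : E3 → ℝ} (hφ : ContDiff ℝ 1 φ) (hc : HasCompactSupport φ)
    (i : Fin 3) : ∫ x, pd i φ x = 0 := by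
  have h := integral_mul_fderiv_eq_neg_fderiv_mul_of_integrable (μ := (volume : Measure E3))
    (f := fun _ => (1 : ℝ)) (g := φ) (v := EuclideanSpace.single i 1)
    (by simp)
    ((integrable_pd hφ hc i).congr (.of_forall fun x => by simp [pd]))
    (by simpa using hφ.continuous.integrable_of_hasCompactSupport hc)
    (fun x _ => differentiableAt_const _) (fun x _ => hφ.differentiable (by simp) x)
  simpa [pd] using h

/-- The flux whose divergence collects the viscous, pressure and convective work. -/
def energyFlux (μ Y : ℝ) (g U : E3 → E3) (p : E3 → ℝ) (i : Fin 3) (x : E3) : ℝ :=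
  μ * (∑ j : Fin 3, U x j * pd i (fun y => U y j) x) - U x i * p x
    - (U x i + g x i * Y) * ((∑ j : Fin 3, U x j * U x j) / 2)

theorem pd_energyFlux {μ Y : ℝ} {g U : E3 → E3} {p : E3 → ℝ} (hg : ContDiff ℝ (⊤ : ℕ∞) g)
    (hU : ContDiff ℝ (⊤ : ℕ∞) U) (hp : ContDiff ℝ 1 p) (i : Fin 3) (x : E3) :
    pd i (energyFlux μ Y g U p i) x
      = μ * (∑ j : Fin 3, (U x j * pd i (fun z => pd i (fun y => U y j) z) x
            + pd i (fun y => U y j) x ^ 2))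
        - (U x i * pd i p x + pd i (fun y => U y i) x * p x)
        - ((U x i + g x i * Y) * (∑ j : Fin 3, U x j * pd i (fun y => U y j) x)
          + (pd i (fun y => U y i) x + pd i (fun y => g y i) x * Y)
            * ((∑ j : Fin 3, U x j * U x j) / 2)) := by
  have hUc : ∀ j, ContDiff ℝ (⊤ : ℕ∞) (fun y => U y j) := contDiff_euclidean.1 hU
  have hgc : ∀ j, ContDiff ℝ (⊤ : ℕ∞) (fun y => g y j) := contDiff_euclidean.1 hg
  have hUd : ∀ j, HasFDerivAt (fun y => U y j) (fderiv ℝ (fun y => U y j) x) x :=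
    fun j => ((hUc j).differentiable (by simp) x).hasFDerivAt
  have hgd : ∀ j, HasFDerivAt (fun y => g y j) (fderiv ℝ (fun y => g y j) x) x :=
    fun j => ((hgc j).differentiable (by simp) x).hasFDerivAt
  have hpd := (hp.differentiable (by simp) x).hasFDerivAt
  have hUU : ∀ j, HasFDerivAt (fun z => pd i (fun y => U y j) z)
      (fderiv ℝ (fun z => pd i (fun y => U y j) z) x) x :=
    fun j => (((hUc j).pd (m := 1) (by norm_cast) i).differentiable (by simp) x).hasFDerivAt
  have key := (((HasFDerivAt.fun_sum (u := Finset.univ)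
      fun j _ => (hUd j).mul (hUU j)).const_mul μ).sub
      ((hUd i).mul hpd)).sub
    (((hUd i).add ((hgd i).mul_const Y)).mul
      ((HasFDerivAt.fun_sum (u := Finset.univ) fun j _ => (hUd j).mul (hUd j)).mul_const (2⁻¹ : ℝ)))
  rw [HasFDerivAt.pd_eq (φ := energyFlux μ Y g U p i) (by exact key) i]
  simp [pd, Fin.sum_univ_three]
  ring

theorem sum_pd_energyFlux {μ Y : ℝ} {g U : E3 → E3} {p : E3 → ℝ} (hg : ContDiff ℝ (⊤ : ℕ∞) g)
    (hU : ContDiff ℝ (⊤ : ℕ∞) U) (hp : ContDiff ℝ 1 p)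
    (hgdiv : ∀ x, (∑ i : Fin 3, pd i (fun y => g y i) x) = 0)
    (hUdiv : ∀ x, (∑ i : Fin 3, pd i (fun y => U y i) x) = 0) (x : E3) :
    ∑ i, pd i (energyFlux μ Y g U p i) x
      = μ * (∑ j, U x j * lap (fun y => U y j) x) + μ * gradSq U x - ∑ j, U x j * pd j p x
        - (∑ j, U x j * ∑ i, (U x i + g x i * Y) * pd i (fun y => U y j + g y j * Y) x)
        + Y * ∑ j, ∑ i, U x j * (U x i + g x i * Y) * pd i (fun y => g y j) x := by
  have hUd : ∀ j, DifferentiableAt ℝ (fun y => U y j) x :=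
    fun j => (contDiff_euclidean.1 hU j).differentiable (by simp) x
  have hgd : ∀ j, DifferentiableAt ℝ (fun y => g y j) x :=
    fun j => (contDiff_euclidean.1 hg j).differentiable (by simp) x
  have hW : ∀ i j, pd i (fun y => U y j + g y j * Y) x
      = pd i (fun y => U y j) x + pd i (fun y => g y j) x * Y := by
    intro i j
    rw [HasFDerivAt.pd_eq (φ := fun y => U y j + g y j * Y)
      ((hUd j).hasFDerivAt.add ((hgd j).hasFDerivAt.mul_const Y))]
    simp [pd, mul_comm]
  have h1 := hgdiv x
  have h2 := hUdiv x
  simp only [pd_energyFlux hg hU hp, hW, lap, gradSq]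
  simp only [Fin.sum_univ_three] at h1 h2 ⊢
  linear_combination (-p x - (U x 0 * U x 0 + U x 1 * U x 1 + U x 2 * U x 2) / 2) * h2
    - Y * (U x 0 * U x 0 + U x 1 * U x 1 + U x 2 * U x 2) / 2 * h1

theorem contDiff_energyFlux {μ Y : ℝ} {g U : E3 → E3} {p : E3 → ℝ} (hg : ContDiff ℝ (⊤ : ℕ∞) g)
    (hU : ContDiff ℝ (⊤ : ℕ∞) U) (hp : ContDiff ℝ 1 p) (i : Fin 3) :
    ContDiff ℝ 1 (energyFlux μ Y g U p i) := by
  have h1 : ∀ j, ContDiff ℝ 1 (fun x => U x j) := fun j =>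
    (contDiff_euclidean.1 hU j).of_le (by norm_cast)
  have h2 : ∀ j, ContDiff ℝ 1 (fun x => g x j) := fun j =>
    (contDiff_euclidean.1 hg j).of_le (by norm_cast)
  have h3 : ∀ j, ContDiff ℝ 1 (pd i (fun x => U x j)) := fun j =>
    (contDiff_euclidean.1 hU j).pd (by norm_cast) i
  unfold energyFlux
  fun_prop

theorem HasCompactSupport.energyFlux {μ Y : ℝ} {g U : E3 → E3} {p : E3 → ℝ}
    (hU : HasCompactSupport U) (i : Fin 3) : HasCompactSupport (energyFlux μ Y g U p i) := by
  refine HasCompactSupport.intro hU fun x hx => ?_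
  have hx0 : U x = 0 := image_eq_zero_of_notMem_tsupport hx
  simp [_root_.energyFlux, hx0]

theorem integrable_gradSq {U : E3 → E3} (hU : ContDiff ℝ (⊤ : ℕ∞) U) (hc : HasCompactSupport U) :
    Integrable (gradSq U) := by
  have hsq : ∀ i j, Integrable fun x => pd i (fun y => U y j) x ^ 2 := by
    intro i j
    have hcj : HasCompactSupport (fun x => U x j) :=
      HasCompactSupport.intro hc fun x hx => by simp [image_eq_zero_of_notMem_tsupport hx]
    have hcpd : HasCompactSupport (pd i fun x => U x j) := hcj.fderiv_apply (𝕜 := ℝ) _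
    have hcont : Continuous (pd i fun x => U x j) :=
      ((contDiff_euclidean.1 hU j).pd (m := 0) (by simp) i).continuous
    exact (hcont.pow 2).integrable_of_hasCompactSupport
      (HasCompactSupport.intro hcpd fun x hx => by simp [image_eq_zero_of_notMem_tsupport hx])
  exact integrable_finsetSum _ fun i _ => integrable_finsetSum _ fun j _ => hsq i j

theorem integrable_norm_rpow {w : E3 → E3} {s : ℝ} (hw : Continuous w) (hc : HasCompactSupport w)
    (hs : 0 < s) : Integrable fun x => ‖w x‖ ^ s :=
  (hw.norm.rpow_const fun _ => Or.inr hs.le).integrable_of_hasCompactSupport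
    (hc.comp_left (g := fun v : E3 => ‖v‖ ^ s) (by simp [Real.zero_rpow hs.ne']))

theorem abs_sum_mul_le {a b : Fin 3 → ℝ} {A B : ℝ} (ha : ∀ j, |a j| ≤ A) (hb : ∀ j, |b j| ≤ B) :
    |∑ j, a j * b j| ≤ 3 * (A * B) := by
  have hA : 0 ≤ A := (abs_nonneg _).trans (ha 0)
  calc |∑ j, a j * b j| ≤ ∑ j, |a j * b j| := Finset.abs_sum_le_sum_abs _ _
    _ ≤ ∑ _j : Fin 3, A * B := Finset.sum_le_sum fun j _ => by
        rw [abs_mul]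
        exact mul_le_mul (ha j) (hb j) (abs_nonneg _) hA
    _ = 3 * (A * B) := by simp

theorem exists_coefficient_bound {g : E3 → E3} (hg : ContDiff ℝ (⊤ : ℕ∞) g)
    (hgc : HasCompactSupport g) :
    ∃ M : ℝ, ∀ x, ‖g x‖ ≤ M ∧ (∀ i j, |pd i (fun z => g z j) x| ≤ M) ∧
      (∀ j, |lap (fun z => g z j) x| ≤ M) ∧
      (x ∉ tsupport g → g x = 0 ∧ (∀ i j, pd i (fun z => g z j) x = 0) ∧
        ∀ j, lap (fun z => g z j) x = 0) := by
  have hgj : ∀ j, ContDiff ℝ (⊤ : ℕ∞) (fun x => g x j) := contDiff_euclidean.1 hg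
  have hz : ∀ x, x ∉ tsupport g → g x = 0 ∧ (∀ i j, pd i (fun z => g z j) x = 0) ∧
        ∀ j, lap (fun z => g z j) x = 0 := by
    intro x hx
    have h0 : g =ᶠ[nhds x] 0 := notMem_tsupport_iff_eventuallyEq.1 hx
    have h1 : ∀ j, (fun z => g z j) =ᶠ[nhds x] fun _ => (0 : ℝ) := fun j =>
      h0.mono fun z hz => by simp [hz]
    have h2 : ∀ i j, pd i (fun z => g z j) =ᶠ[nhds x] fun _ => (0 : ℝ) := fun i j =>
      ((h1 j).fderiv (𝕜 := ℝ)).mono fun z hz => by simp [pd, hz]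
    refine ⟨h0.eq_of_nhds, fun i j => (h2 i j).eq_of_nhds, fun j => ?_⟩
    refine Finset.sum_eq_zero fun i _ => ?_
    have h3 := (h2 i j).fderiv_eq (𝕜 := ℝ)
    change fderiv ℝ (pd i fun z => g z j) x _ = 0
    rw [h3]
    simp
  have hc1 : ∀ i j, Continuous (pd i (fun z => g z j)) := fun i j =>
    ((hgj j).pd (m := 0) (by simp) i).continuous
  have hc2 : ∀ j, Continuous (lap (fun z => g z j)) := fun j =>
    continuous_finsetSum _ fun i _ =>
      (((hgj j).pd (m := 1) (by norm_cast) i).pd (m := 0) (by simp) i).continuous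
  have hφ : Continuous fun x => ‖g x‖ + (∑ i, ∑ j, |pd i (fun z => g z j) x|)
      + ∑ j, |lap (fun z => g z j) x| := by
    have := hg.continuous
    fun_prop
  obtain ⟨M, hM⟩ := hφ.bounded_above_of_compact_support
    (HasCompactSupport.intro hgc fun x hx => by
      obtain ⟨h1, h2, h3⟩ := hz x hx
      simp [h1, h2, h3])
  refine ⟨M, fun x => ?_⟩
  have hMx := (le_abs_self _).trans (hM x)
  have n1 := norm_nonneg (g x)
  have n2 : 0 ≤ ∑ i, ∑ j, |pd i (fun z => g z j) x| := by positivity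
  have n3 : 0 ≤ ∑ j, |lap (fun z => g z j) x| := by positivity
  refine ⟨by linarith, fun i j => ?_, fun j => ?_, hz x⟩
  · have s1 := Finset.single_le_sum (f := fun j => |pd i (fun z => g z j) x|)
      (fun _ _ => abs_nonneg _) (Finset.mem_univ j)
    have s2 := Finset.single_le_sum (f := fun i => ∑ j, |pd i (fun z => g z j) x|)
      (fun _ _ => by positivity) (Finset.mem_univ i)
    simp only at s1 s2
    linarith
  · have s1 := Finset.single_le_sum (f := fun j => |lap (fun z => g z j) x|)
      (fun _ _ => abs_nonneg _) (Finset.mem_univ j)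
    simp only at s1
    linarith

theorem hasDerivAt_integral_norm_sq {u : ℝ → E3 → E3}
    (hu : ContDiff ℝ (⊤ : ℕ∞) (fun q : ℝ × E3 => u q.1 q.2))
    (hsupp : ∀ a b : ℝ, ∃ K : Set E3, IsCompact K ∧
      ∀ t ∈ Set.Icc a b, ∀ x : E3, x ∉ K → u t x = 0) (t : ℝ) :
    Integrable (fun x : E3 => ∑ j : Fin 3, 2 * (u t x j * deriv (fun s => u s x j) t)) ∧
    HasDerivAt (fun s => ∫ x : E3, ‖u s x‖ ^ 2)
      (∫ x : E3, ∑ j : Fin 3, 2 * (u t x j * deriv (fun s => u s x j) t)) t := by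
  obtain ⟨K, hK, h0⟩ := hsupp (t - 1) (t + 1)
  have huj : ∀ j, ContDiff ℝ (⊤ : ℕ∞) (fun q : ℝ × E3 => u q.1 q.2 j) := contDiff_euclidean.1 hu
  have hd : ∀ j s x, HasDerivAt (fun s => u s x j)
      (fderiv ℝ (fun q : ℝ × E3 => u q.1 q.2 j) (s, x) (1, 0)) s := by
    intro j s x
    have h1 := ((huj j).differentiable (by simp) (s, x)).hasFDerivAt
    exact h1.comp_hasDerivAt s ((hasDerivAt_id s).prodMk (hasDerivAt_const s x))
  have hF' : Continuous fun q : ℝ × E3 =>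
      ∑ j : Fin 3, 2 * (u q.1 q.2 j * deriv (fun s => u s q.2 j) q.1) := by
    simp only [fun j s x => (hd j s x).deriv]
    refine continuous_finsetSum _ fun j _ => continuous_const.mul ((huj j).continuous.mul ?_)
    exact ((huj j).continuous_fderiv (by simp)).clm_apply continuous_const
  have hucont : ∀ s, Continuous (u s) := fun s =>
    hu.continuous.comp (Continuous.prodMk_right s)
  obtain ⟨C, hC⟩ := (isCompact_Icc (a := t - 1) (b := t + 1)).prod hK
    |>.exists_bound_of_continuousOn hF'.continuousOn
  have hmem : Set.Icc (t - 1) (t + 1) ∈ nhds t := Icc_mem_nhds (by linarith) (by linarith)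
  refine hasDerivAt_integral_of_dominated_loc_of_deriv_le (F := fun s x => ‖u s x‖ ^ 2)
    (F' := fun s x => ∑ j : Fin 3, 2 * (u s x j * deriv (fun s => u s x j) s))
    (bound := K.indicator fun _ => C) hmem
    (Eventually.of_forall fun s => ((hucont s).norm.pow 2).aestronglyMeasurable) ?_
    (hF'.comp (Continuous.prodMk_right t)).aestronglyMeasurable ?_ ?_ ?_
  · exact ((hucont t).norm.pow 2).integrable_of_hasCompactSupport
      (HasCompactSupport.intro hK fun x hx => by
        simp [h0 t ⟨by linarith, by linarith⟩ x hx])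
  · refine Eventually.of_forall fun x s hs => ?_
    by_cases hx : x ∈ K
    · simpa [hx] using hC (s, x) ⟨hs, hx⟩
    · simp [hx, h0 s hs x hx]
  · exact (integrable_indicator_iff hK.measurableSet).2 (integrableOn_const hK.measure_lt_top.ne)
  · refine Eventually.of_forall fun x s _ => ?_
    simp only [EuclideanSpace.real_norm_sq_eq]
    refine HasDerivAt.fun_sum fun j _ => ?_
    have h := (hd j s x).differentiableAt.hasDerivAt.fun_pow 2
    refine h.congr_deriv ?_
    push_cast
    ring

theorem energy_density_le {μ α β σ r Y M C : ℝ} (hμ : 0 < μ) (hβ : 0 < β) (hr : 3 ≤ r)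
    {g : E3 → E3} (hg : ContDiff ℝ (⊤ : ℕ∞) g)
    (hgdiv : ∀ x, (∑ i : Fin 3, pd i (fun z => g z i) x) = 0)
    (hCb : ∀ a b Y F : ℝ, 0 ≤ a → 0 ≤ b → 0 ≤ Y → 0 ≤ F →
      2 * (9 * M * Y * b * a + 3 * β * M * Y * b ^ r + 3 * F * a
          + (3 * |σ - α| * M + 3 * μ * M) * Y * a)
        ≤ α / 2 * a ^ 2 + β * b ^ (r + 1)
          + C * (F ^ 2 + (Y ^ 2 + Y ^ (r + 1) + Y ^ (2 * (r + 1) / (r - 1)))))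
    {x : E3} (hMx : ‖g x‖ ≤ M ∧ (∀ i j, |pd i (fun z => g z j) x| ≤ M) ∧
      (∀ j, |lap (fun z => g z j) x| ≤ M) ∧
      (x ∉ tsupport g → g x = 0 ∧ (∀ i j, pd i (fun z => g z j) x = 0) ∧
        ∀ j, lap (fun z => g z j) x = 0))
    {U : E3 → E3} (hU : ContDiff ℝ (⊤ : ℕ∞) U)
    (hUdiv : ∀ x, (∑ i : Fin 3, pd i (fun z => U z i) x) = 0)
    {p : E3 → ℝ} (hp : ContDiff ℝ 1 p) {d : Fin 3 → ℝ} {F : E3}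
    (heq : ∀ j : Fin 3, d j - μ * lap (fun z => U z j) x
        + (∑ i : Fin 3, (U x i + g x i * Y) * pd i (fun z => U z j + g z j * Y) x)
        + α * U x j + β * ‖U x + Y • g x‖ ^ (r - 1) * (U x j + g x j * Y)
      = -(pd j p x) + F j + (σ - α) * (g x j * Y) + μ * Y * lap (fun z => g z j) x) :
    (∑ j : Fin 3, 2 * (U x j * d j))
        + 3 * α / 2 * ‖U x‖ ^ 2 + μ * gradSq U x + β * ‖U x + Y • g x‖ ^ (r + 1)
      ≤ 2 * (∑ i, pd i (energyFlux μ Y g U p i) x)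
        + C * (‖F‖ ^ 2 + (tsupport g).indicator
          (fun _ => |Y| ^ 2 + |Y| ^ (r + 1) + |Y| ^ (2 * (r + 1) / (r - 1))) x) := by
  set P := |Y| ^ 2 + |Y| ^ (r + 1) + |Y| ^ (2 * (r + 1) / (r - 1)) with hP
  set Y' := (tsupport g).indicator (fun _ => |Y|) x with hY'
  have hY'0 : 0 ≤ Y' := Set.indicator_nonneg (fun _ _ => abs_nonneg _) _
  have hPY : Y' ^ 2 + Y' ^ (r + 1) + Y' ^ (2 * (r + 1) / (r - 1))
      = (tsupport g).indicator (fun _ => P) x := by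
    by_cases hx : x ∈ tsupport g
    · simp [hY', hx, hP]
    · have h1 : 2 * (r + 1) / (r - 1) ≠ 0 :=
        (div_pos (by linarith) (by linarith)).ne'
      simp [hY', hx, Real.zero_rpow (by linarith : r + 1 ≠ 0), Real.zero_rpow h1]
  have hcoef : ∀ c : ℝ, |c| ≤ M → (x ∉ tsupport g → c = 0) → |Y * c| ≤ M * Y' := by
    intro c hc hc0
    by_cases hx : x ∈ tsupport g
    · simp only [hY', hx, Set.indicator_of_mem, abs_mul]
      rw [mul_comm]
      gcongr
    · simp [hY', hx, hc0 hx]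
  obtain ⟨hg1, hg2, hg3, hg4⟩ := hMx
  have hg1' : ∀ j, |Y * g x j| ≤ M * Y' := fun j => hcoef _
    ((PiLp.norm_apply_le (g x) j).trans hg1) fun h => by simp [(hg4 h).1]
  have hg2' : ∀ i j, |Y * pd i (fun z => g z j) x| ≤ M * Y' := fun i j => hcoef _
    (hg2 i j) fun h => (hg4 h).2.1 i j
  have hg3' : ∀ j, |Y * lap (fun z => g z j) x| ≤ M * Y' := fun j => hcoef _
    (hg3 j) fun h => (hg4 h).2.2 j
  set w := U x + Y • g x with hw
  have hwj : ∀ j, w j = U x j + g x j * Y := fun j => by simp [hw, mul_comm]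
  have hUa : ∀ j, |U x j| ≤ ‖U x‖ := PiLp.norm_apply_le (U x)
  have hWa : ∀ j, |w j| ≤ ‖w‖ := PiLp.norm_apply_le w
  have hFa : ∀ j, |F j| ≤ ‖F‖ := PiLp.norm_apply_le F
  have b1 := abs_sum_mul_le hUa fun j => abs_sum_mul_le hWa fun i => hg2' i j
  have b2 := abs_sum_mul_le hWa hg1'
  have b3 := abs_sum_mul_le hFa hUa
  have b4 := abs_sum_mul_le hUa hg1'
  have b5 := abs_sum_mul_le hUa hg3'
  have hflux := sum_pd_energyFlux (μ := μ) (Y := Y) hg hU hp hgdiv hUdiv x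
  have habs := hCb ‖U x‖ ‖w‖ Y' ‖F‖ (norm_nonneg _) (norm_nonneg _) hY'0 (norm_nonneg _)
  rw [hPY] at habs
  have hU2 := EuclideanSpace.real_norm_sq_eq (U x)
  have hW2 := EuclideanSpace.real_norm_sq_eq w
  have e1 : ‖w‖ ^ (r + 1) = ‖w‖ ^ (r - 1) * ‖w‖ ^ 2 := by
    rw [← Real.rpow_natCast ‖w‖ 2,
      ← Real.rpow_add_of_nonneg (norm_nonneg _) (by linarith) (by norm_num)]
    congr 1
    push_cast
    ring
  have e2 : ‖w‖ ^ r = ‖w‖ ^ (r - 1) * ‖w‖ := by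
    conv_rhs => rw [← Real.rpow_one ‖w‖, ← Real.rpow_mul (norm_nonneg _), one_mul]
    rw [← Real.rpow_add_of_nonneg (norm_nonneg _) (by linarith) (by norm_num)]
    congr 1
    ring
  set N := ‖w‖ ^ (r - 1) with hN
  have hN0 : 0 ≤ N := by positivity
  have henergy : ∑ j : Fin 3, 2 * (U x j * d j)
      = 2 * (∑ i, pd i (energyFlux μ Y g U p i) x) - 2 * μ * gradSq U x
        - 2 * α * ‖U x‖ ^ 2 - 2 * β * ‖w‖ ^ (r + 1)
        - 2 * (∑ j, U x j * ∑ i, w i * (Y * pd i (fun z => g z j) x))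
        + 2 * (β * (N * ∑ j, w j * (Y * g x j)))
        + 2 * (∑ j, F j * U x j)
        + 2 * ((σ - α) * ∑ j, U x j * (Y * g x j))
        + 2 * (μ * ∑ j, U x j * (Y * lap (fun z => g z j) x)) := by
    rw [hflux, e1, hU2, hW2]
    have q0 := heq 0
    have q1 := heq 1
    have q2 := heq 2
    simp only [← hwj] at q0 q1 q2 ⊢
    simp only [Fin.sum_univ_three] at q0 q1 q2 ⊢
    have r0 := hwj 0
    have r1 := hwj 1
    have r2 := hwj 2
    linear_combination 2 * U x 0 * q0 + 2 * U x 1 * q1 + 2 * U x 2 * q2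
      + 2 * β * N * (w 0 * r0 + w 1 * r1 + w 2 * r2)
  have c1 := (neg_le_abs _).trans b1
  have c2 := mul_le_mul_of_nonneg_left (mul_le_mul_of_nonneg_left ((le_abs_self _).trans b2) hN0)
    hβ.le
  have c3 := (le_abs_self _).trans b3
  have c4 := (le_abs_self _).trans ((abs_mul (σ - α) _).le.trans
    (mul_le_mul_of_nonneg_left b4 (abs_nonneg (σ - α))))
  have c5 := mul_le_mul_of_nonneg_left ((le_abs_self _).trans b5) hμ.le
  have hG0 : 0 ≤ μ * gradSq U x :=
    mul_nonneg hμ.le (Finset.sum_nonneg fun i _ => Finset.sum_nonneg fun j _ => sq_nonneg _)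
  rw [henergy]
  rw [e2] at habs
  linarith

theorem integral_le_of_density_le {G a b w Ψ F k : E3 → ℝ} {c₁ c₂ c₃ C : ℝ} (hG : Integrable G)
    (ha : Integrable a) (hb : Integrable b) (hw : Integrable w) (hΨ : Integrable Ψ)
    (hF : Integrable F) (hk : Integrable k)
    (h : ∀ x, G x + c₁ * a x + c₂ * b x + c₃ * w x ≤ 2 * Ψ x + C * (F x + k x)) :
    (∫ x, G x) + c₁ * (∫ x, a x) + c₂ * (∫ x, b x) + c₃ * (∫ x, w x)
      ≤ 2 * (∫ x, Ψ x) + C * ((∫ x, F x) + ∫ x, k x) := by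
  have i1 : Integrable fun x => G x + c₁ * a x := hG.add (ha.const_mul c₁)
  have i2 : Integrable fun x => G x + c₁ * a x + c₂ * b x := i1.add (hb.const_mul c₂)
  have i3 : Integrable fun x => G x + c₁ * a x + c₂ * b x + c₃ * w x := i2.add (hw.const_mul c₃)
  have i4 : Integrable fun x => F x + k x := hF.add hk
  have i5 : Integrable fun x => 2 * Ψ x + C * (F x + k x) :=
    (hΨ.const_mul 2).add (i4.const_mul C)
  have hmono := integral_mono i3 i5 h
  rwa [integral_add i2 (hw.const_mul c₃), integral_add i1 (hb.const_mul c₂),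
    integral_add hG (ha.const_mul c₁), integral_add (hΨ.const_mul 2) (i4.const_mul C),
    integral_const_mul, integral_const_mul, integral_const_mul, integral_const_mul,
    integral_const_mul, integral_add hF hk] at hmono

/-- First energy inequality (4.4) of Lemma 4.1, for classical spatially compactly
supported solutions of the transformed 3D stochastic CBF equations with additive
noise (`r ≥ 3`, and `2βμ ≥ 1` if `r = 3`):
`E′(t) + (3α/2)E(t) + μ∫|∇u|² dx + β∫|u + g y(t)|^{r+1} dx
  ≤ R (∫|f|² dx + |y(t)|² + |y(t)|^{r+1} + |y(t)|^{2(r+1)/(r−1)})`,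
where `E(t) = ∫|u(t)|² dx`. -/
theorem stmt16 (μ α β σ r : ℝ) (hμ : 0 < μ) (hα : 0 < α) (hβ : 0 < β) (hσ : 0 < σ)
    (hr : 3 ≤ r) (hr3 : r = 3 → 1 ≤ 2 * β * μ)
    (g : E3 → E3) (hg : ContDiff ℝ (⊤ : ℕ∞) g) (hgc : HasCompactSupport g)
    (hgdiv : ∀ x, (∑ i : Fin 3, pd i (fun y' => g y' i) x) = 0) :
    ∃ R : ℝ, 0 < R ∧
      ∀ (y : ℝ → ℝ), Continuous y →
      ∀ (f : ℝ → E3 → E3), Continuous (Function.uncurry f) →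
        (∀ t, Integrable (fun x : E3 => ‖f t x‖ ^ 2)) →
      ∀ (u : ℝ → E3 → E3),
        ContDiff ℝ (⊤ : ℕ∞) (fun q : ℝ × E3 => u q.1 q.2) →
        (∀ a b : ℝ, ∃ K : Set E3, IsCompact K ∧
          ∀ t ∈ Set.Icc a b, ∀ x : E3, x ∉ K → u t x = 0) →
        (∀ t x, (∑ i : Fin 3, pd i (fun y' => u t y' i) x) = 0) →
      ∀ (p : ℝ → E3 → ℝ), (∀ t, ContDiff ℝ 1 (p t)) →
        (∀ (t : ℝ) (x : E3) (j : Fin 3),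
          deriv (fun s => u s x j) t - μ * lap (fun y' => u t y' j) x
            + (∑ i : Fin 3, (u t x i + g x i * y t) *
                pd i (fun y' => u t y' j + g y' j * y t) x)
            + α * u t x j
            + β * ‖u t x + y t • g x‖ ^ (r - 1) * (u t x j + g x j * y t)
          = -(pd j (p t) x) + f t x j + (σ - α) * (g x j * y t)
            + μ * y t * lap (fun y' => g y' j) x) →
      (∀ t : ℝ, DifferentiableAt ℝ (fun s => ∫ x : E3, ‖u s x‖ ^ 2) t) ∧
      ∀ t : ℝ,
        deriv (fun s => ∫ x : E3, ‖u s x‖ ^ 2) t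
          + 3 * α / 2 * (∫ x : E3, ‖u t x‖ ^ 2)
          + μ * (∫ x : E3, gradSq (u t) x)
          + β * (∫ x : E3, ‖u t x + y t • g x‖ ^ (r + 1))
        ≤ R * ((∫ x : E3, ‖f t x‖ ^ 2) + |y t| ^ 2 + |y t| ^ (r + 1)
            + |y t| ^ (2 * (r + 1) / (r - 1))) := by
  obtain ⟨M, hM⟩ := exists_coefficient_bound hg hgc
  have hM0 : 0 ≤ M := (norm_nonneg _).trans (hM 0).1
  obtain ⟨C, hC, hCb⟩ := exists_absorption_const hα hβ hr (9 * M) (3 * β * M) 3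
    (3 * |σ - α| * M + 3 * μ * M) (by positivity)
  set V := volume.real (tsupport g) with hV
  have hV0 : 0 ≤ V := measureReal_nonneg
  refine ⟨C * (1 + V) + 1, by positivity, ?_⟩
  intro y hy f hf hfi u hu hsupp hdiv p hp heq
  have hE := fun t => hasDerivAt_integral_norm_sq hu hsupp t
  refine ⟨fun t => (hE t).2.differentiableAt, fun t => ?_⟩
  rw [(hE t).2.deriv]
  have hut : ContDiff ℝ (⊤ : ℕ∞) (u t) := hu.comp (contDiff_prodMk_right t)
  have hutc : HasCompactSupport (u t) := by
    obtain ⟨K, hK, h0⟩ := hsupp t t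
    exact HasCompactSupport.intro hK (h0 t (by simp))
  have hΦ := fun i => contDiff_energyFlux (μ := μ) (Y := y t) hg hut (hp t) i
  have hΦc := fun i => hutc.energyFlux (μ := μ) (Y := y t) (g := g) (p := p t) i
  have iΦ := fun i => integrable_pd (hΦ i) (hΦc i) i
  have iU : Integrable (fun x => ‖u t x‖ ^ 2) :=
    (hut.continuous.norm.pow 2).integrable_of_hasCompactSupport
      (HasCompactSupport.intro hutc fun x hx => by simp [image_eq_zero_of_notMem_tsupport hx])
  have iG := integrable_gradSq hut hutc
  have hwcont : Continuous fun x => u t x + y t • g x := by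
    have h1 := hut.continuous
    have h2 := hg.continuous
    fun_prop
  have hwc : HasCompactSupport fun x => u t x + y t • g x :=
    hutc.add (hgc.smul_left (f := fun _ => y t))
  have iW := integrable_norm_rpow hwcont hwc (show 0 < r + 1 by linarith)
  set P := |y t| ^ 2 + |y t| ^ (r + 1) + |y t| ^ (2 * (r + 1) / (r - 1)) with hP
  have hP0 : 0 ≤ P := by positivity
  have iK : Integrable ((tsupport g).indicator fun _ => P) :=
    (integrable_indicator_iff (isClosed_tsupport g).measurableSet).2
      (integrableOn_const hgc.measure_lt_top.ne)
  have hpt : ∀ x, (∑ j : Fin 3, 2 * (u t x j * deriv (fun s => u s x j) t))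
        + 3 * α / 2 * ‖u t x‖ ^ 2 + μ * gradSq (u t) x + β * ‖u t x + y t • g x‖ ^ (r + 1)
      ≤ 2 * (∑ i, pd i (energyFlux μ (y t) g (u t) (p t) i) x)
        + C * (‖f t x‖ ^ 2 + (tsupport g).indicator (fun _ => P) x) := by
    intro x
    exact energy_density_le hμ hβ hr hg hgdiv hCb (hM x) hut (hdiv t) (hp t)
      (heq t x)
  have hΨ : ∫ x, ∑ i, pd i (energyFlux μ (y t) g (u t) (p t) i) x = 0 := by
    rw [integral_finsetSum _ fun i _ => iΦ i]
    exact Finset.sum_eq_zero fun i _ => integral_pd_eq_zero (hΦ i) (hΦc i) i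
  have hIK : ∫ x, (tsupport g).indicator (fun _ => P) x = V * P := by
    rw [integral_indicator (isClosed_tsupport g).measurableSet, setIntegral_const, smul_eq_mul]
  have hmain := integral_le_of_density_le (hE t).1 iU iG iW
    (integrable_finsetSum Finset.univ fun i _ => iΦ i) (hfi t) iK hpt
  rw [hΨ, hIK] at hmain
  refine hmain.trans ?_
  have hF0 : 0 ≤ ∫ x, ‖f t x‖ ^ 2 := integral_nonneg fun x => by positivity
  set I := ∫ x, ‖f t x‖ ^ 2
  have hsum : I + |y t| ^ 2 + |y t| ^ (r + 1) + |y t| ^ (2 * (r + 1) / (r - 1)) = I + P := by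
    rw [hP]; ring
  rw [hsum]
  have m1 : 0 ≤ C * V * I := by positivity
  have m2 : 0 ≤ C * P := by positivity
  linarith [mul_add C I (V * P), mul_assoc C V I, mul_assoc C V P]

end
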